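/- Let V ∈ H₊^{−m}. The operator S₊(V) is selfadjoint if and only if V is real-valued, i.e., if and only if its Fourier coefficients satisfy V̂(2k) = conjugate(V̂(−2k)) for all k ∈ ℤ. -/

import Mathlib

/- STATEMENT 12: For V ∈ H₊^{−m}, the form-sum operator
S₊(V) = D₊^{2m} ∔ V on L²(0,1) is selfadjoint iff V is real-valued,
i.e. iff V̂(2k) = conj(V̂(−2k)) for all k.  Model: L²(0,1) ≅ ℓ²(ℤ) via
Fourier coefficients (û(2k)); S₊(V) is encoded by its graph
{(u,w) : u ∈ H₊^m, w ∈ ℓ², w = D₊^{2m}u + V·u}; selfadjointness means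
the graph coincides with the graph of the adjoint. -/

noncomputable section
open Complex

def wtp (s : ℝ) (k : ℤ) : ℝ := ((1 + |(2 * k : ℤ)| : ℝ)) ^ (2 * s)

def conv (a b : ℤ → ℂ) (k : ℤ) : ℂ := ∑' j : ℤ, a (k - j) * b j

/-- The symbol of `D₊^{2m}`: the eigenvalue `(2kπ)^{2m}` on `e^{i2kπx}`. -/
def cplus (m : ℕ) (k : ℤ) : ℝ := (2 * Real.pi * (k : ℝ)) ^ (2 * m)

/-- The `L²(0,1)` inner product `(f,g) = ∫ f ḡ` in Fourier coordinates. -/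
def L2inner (f g : ℤ → ℂ) : ℂ := ∑' k : ℤ, f k * (starRingEnd ℂ) (g k)

/-- The graph of the form-sum operator `S₊(V) = D₊^{2m} ∔ V`. -/
def graphS (m : ℕ) (V : ℤ → ℂ) : Set ((ℤ → ℂ) × (ℤ → ℂ)) :=
  {p | (Summable fun k : ℤ => wtp (m : ℝ) k * ‖p.1 k‖ ^ 2) ∧
       (Summable fun k : ℤ => ‖p.2 k‖ ^ 2) ∧
       ∀ k : ℤ, p.2 k = (cplus m k : ℂ) * p.1 k + conv V p.1 k}

/-- The graph of the adjoint of the (densely defined) operator with graph `G`. -/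
def adjGraph (G : Set ((ℤ → ℂ) × (ℤ → ℂ))) : Set ((ℤ → ℂ) × (ℤ → ℂ)) :=
  {q | (Summable fun k : ℤ => ‖q.1 k‖ ^ 2) ∧
       (Summable fun k : ℤ => ‖q.2 k‖ ^ 2) ∧
       ∀ p ∈ G, L2inner p.2 q.1 = L2inner p.1 q.2}


lemma wtp_nat (m : ℕ) (k : ℤ) : wtp (m:ℝ) k = (1 + 2 * |(k:ℝ)|) ^ (2 * m) := by
  unfold wtp
  rw [show (2 * (m:ℝ)) = ((2*m : ℕ) : ℝ) by push_cast; ring, Real.rpow_natCast]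
  congr 2
  push_cast
  rw [abs_mul]; norm_num

lemma wtp_neg (m : ℕ) (k : ℤ) : wtp (-(m:ℝ)) k = (wtp (m:ℝ) k)⁻¹ := by
  unfold wtp
  rw [← Real.rpow_neg (by positivity)]
  congr 1; ring

lemma wtp_ge_one (m : ℕ) (k : ℤ) : 1 ≤ wtp (m:ℝ) k := by
  rw [wtp_nat]
  exact one_le_pow₀ (by linarith [abs_nonneg (k:ℝ)])

lemma cplus_eq (m : ℕ) (k : ℤ) : cplus m k = (2 * Real.pi * |(k:ℝ)|) ^ (2 * m) := by
  unfold cplus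
  rw [pow_mul, pow_mul]
  congr 1
  rw [mul_pow, mul_pow _ |(k:ℝ)|, sq_abs]

lemma cplus_nonneg (m : ℕ) (k : ℤ) : 0 ≤ cplus m k := by
  rw [cplus_eq]; have := Real.pi_pos; positivity

lemma wtp_le (m : ℕ) (k : ℤ) : wtp (m:ℝ) k ≤ cplus m k + 1 := by
  rw [wtp_nat, cplus_eq]
  by_cases h : k = 0
  · subst h; simp
  · have h1 : (1:ℝ) ≤ |(k:ℝ)| := by exact_mod_cast Int.one_le_abs h
    have : (1 + 2 * |(k:ℝ)|) ^ (2 * m) ≤ (2 * Real.pi * |(k:ℝ)|) ^ (2 * m) := by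
      apply pow_le_pow_left₀ (by positivity)
      nlinarith [Real.pi_gt_three]
    linarith

lemma cplus_le (m : ℕ) (k : ℤ) : cplus m k ≤ Real.pi ^ (2 * m) * wtp (m:ℝ) k := by
  rw [wtp_nat, cplus_eq, ← mul_pow]
  have := Real.pi_pos
  apply pow_le_pow_left₀ (by positivity)
  nlinarith [abs_nonneg (k:ℝ)]

lemma wtp_sub (m : ℕ) (k j : ℤ) :
    wtp (m:ℝ) (k - j) ≤ 4 ^ m * (wtp (m:ℝ) k + wtp (m:ℝ) j) := by
  rw [wtp_nat, wtp_nat, wtp_nat]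
  have h4 : (4:ℝ)^m = 2 ^ (2*m) := by rw [pow_mul]; norm_num
  have h : (1 + 2 * |((k - j : ℤ):ℝ)|) ≤ 2 * max (1 + 2 * |(k:ℝ)|) (1 + 2 * |(j:ℝ)|) := by
    have := abs_sub (k:ℝ) j
    push_cast
    have h1 := le_max_left (1 + 2 * |(k:ℝ)|) (1 + 2 * |(j:ℝ)|)
    have h2 := le_max_right (1 + 2 * |(k:ℝ)|) (1 + 2 * |(j:ℝ)|)
    linarith
  calc _ ≤ (2 * max (1 + 2 * |(k:ℝ)|) (1 + 2 * |(j:ℝ)|)) ^ (2*m) :=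
        pow_le_pow_left₀ (by positivity) h _
    _ ≤ _ := by
      rw [mul_pow, h4]
      apply mul_le_mul_of_nonneg_left _ (by positivity)
      rcases max_cases (1 + 2 * |(k:ℝ)|) (1 + 2 * |(j:ℝ)|) with h | h
      · rw [h.1]; exact le_add_of_nonneg_right (by positivity)
      · rw [h.1]; exact le_add_of_nonneg_left (by positivity)

lemma summable_inv_one (m : ℕ) (hm : 1 ≤ m) : Summable fun k : ℤ => (cplus m k + 1)⁻¹ := by
  have h := (Real.summable_one_div_int_add_rpow (1/2) 2).2 (by norm_num)
  refine Summable.of_nonneg_of_le (fun k => inv_nonneg.2 (by linarith [cplus_nonneg m k])) ?_ h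
  intro k
  rw [one_div]
  have hne : (0:ℝ) < |(k:ℝ) + 1/2| := by
    rw [abs_pos]
    intro h0
    have : (2 * k + 1 : ℝ) = 0 := by linarith
    have h2 : (2 * k + 1 : ℤ) = 0 := by exact_mod_cast this
    omega
  apply inv_anti₀ (by positivity)
  refine le_trans ?_ (wtp_le m k)
  rw [wtp_nat, pow_mul]
  have h1 : |(k:ℝ) + 1/2| ≤ 1 + 2 * |(k:ℝ)| := by
    have := abs_add_le (k:ℝ) (1/2)
    rw [abs_of_pos (by norm_num : (0:ℝ) < 1/2)] at this
    linarith [abs_nonneg (k:ℝ)]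
  have h2 : |(k:ℝ) + 1/2| ^ (2:ℝ) ≤ (1 + 2 * |(k:ℝ)|)^2 := by
    rw [show (2:ℝ) = ((2:ℕ):ℝ) by norm_num, Real.rpow_natCast]
    push_cast
    exact pow_le_pow_left₀ (by positivity) h1 _
  refine h2.trans ?_
  apply le_self_pow₀ _ (by omega)
  exact one_le_pow₀ (by linarith [abs_nonneg (k:ℝ)])

lemma summable_inv (m : ℕ) (hm : 1 ≤ m) (l : ℝ) (hl : 1 ≤ l) :
    Summable fun k : ℤ => (cplus m k + l)⁻¹ := by
  refine Summable.of_nonneg_of_le (fun k => inv_nonneg.2 (by linarith [cplus_nonneg m k])) ?_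
    (summable_inv_one m hm)
  intro k
  exact inv_anti₀ (by linarith [cplus_nonneg m k]) (by linarith)

lemma tendsto_inv_sum (m : ℕ) (hm : 1 ≤ m) :
    Filter.Tendsto (fun l : ℝ => ∑' k : ℤ, (cplus m k + l)⁻¹) Filter.atTop (nhds 0) := by
  have := tendsto_tsum_of_dominated_convergence (𝓕 := Filter.atTop)
    (f := fun (l : ℝ) (k : ℤ) => (cplus m k + l)⁻¹) (g := fun _ => (0:ℝ)) (summable_inv_one m hm)
    (fun k => (Filter.tendsto_atTop_add_const_left _ _ Filter.tendsto_id).inv_tendsto_atTop)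
    (by
      filter_upwards [Filter.eventually_ge_atTop 1] with l hl k
      have := cplus_nonneg m k
      rw [Real.norm_of_nonneg (inv_nonneg.2 (by linarith))]
      exact inv_anti₀ (by linarith) (by linarith))
  simpa using this

def eqv1 : ℤ × ℤ ≃ ℤ × ℤ where
  toFun p := (p.1 - p.2, p.2)
  invFun p := (p.1 + p.2, p.2)
  left_inv p := by simp
  right_inv p := by simp

def eqv2 : ℤ × ℤ ≃ ℤ × ℤ where
  toFun p := (p.1 - p.2, p.1)
  invFun p := (p.2, p.2 - p.1)
  left_inv p := by simp
  right_inv p := by simp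

def kap (m : ℕ) (V : ℤ → ℂ) (l : ℝ) (k j : ℤ) : ℂ :=
  V (k - j) / ((√(cplus m k + l) : ℂ) * (√(cplus m j + l) : ℂ))

lemma kap_sum (m : ℕ) (hm : 1 ≤ m) (V : ℤ → ℂ)
    (hV : Summable fun k : ℤ => wtp (-(m : ℝ)) k * ‖V k‖ ^ 2) (l : ℝ) (hl : 1 ≤ l) :
    (Summable fun p : ℤ × ℤ => ‖kap m V l p.1 p.2‖ ^ 2) ∧
    ∑' p : ℤ × ℤ, ‖kap m V l p.1 p.2‖ ^ 2 ≤ 4 ^ m * (2 *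
      ((∑' k : ℤ, wtp (-(m : ℝ)) k * ‖V k‖ ^ 2) * ∑' k : ℤ, (cplus m k + l)⁻¹)) := by
  set A : ℤ → ℝ := fun k : ℤ => wtp (-(m : ℝ)) k * ‖V k‖ ^ 2 with hA
  set B : ℤ → ℝ := fun k : ℤ => (cplus m k + l)⁻¹ with hB
  have hBs : Summable B := summable_inv m hm l hl
  have hw : ∀ k, 0 < wtp (m:ℝ) k := fun k => by linarith [wtp_ge_one m k]
  have hA0 : 0 ≤ A := fun k => by
    simp only [hA, wtp_neg]; have := hw k; positivity
  have hc : ∀ k, 0 < cplus m k + l := fun k => by linarith [cplus_nonneg m k]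
  have hB0 : 0 ≤ B := fun k => inv_nonneg.2 (hc k).le
  have hAB : Summable fun p : ℤ × ℤ => A p.1 * B p.2 := hV.mul_of_nonneg hBs hA0 hB0
  have hABt : (∑' k, A k) * ∑' k, B k = ∑' p : ℤ × ℤ, A p.1 * B p.2 :=
    hV.tsum_mul_tsum hBs hAB
  have h1 : HasSum (fun p : ℤ × ℤ => A (p.1 - p.2) * B p.2) ((∑' k, A k) * ∑' k, B k) := by
    rw [hABt]
    exact (eqv1.hasSum_iff (f := fun p : ℤ × ℤ => A p.1 * B p.2)).2 hAB.hasSum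
  have h2 : HasSum (fun p : ℤ × ℤ => A (p.1 - p.2) * B p.1) ((∑' k, A k) * ∑' k, B k) := by
    rw [hABt]
    exact (eqv2.hasSum_iff (f := fun p : ℤ × ℤ => A p.1 * B p.2)).2 hAB.hasSum
  have h3 := (h1.add h2).mul_left (4 ^ m : ℝ)
  rw [← two_mul] at h3
  have hle : ∀ p : ℤ × ℤ, ‖kap m V l p.1 p.2‖ ^ 2 ≤
      4 ^ m * (A (p.1 - p.2) * B p.2 + A (p.1 - p.2) * B p.1) := by
    rintro ⟨k, j⟩
    simp only [kap, hA, hB, wtp_neg]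
    rw [norm_div, norm_mul, div_pow, mul_pow, Complex.norm_real, Complex.norm_real,
      Real.norm_of_nonneg (Real.sqrt_nonneg _), Real.norm_of_nonneg (Real.sqrt_nonneg _),
      Real.sq_sqrt (hc k).le, Real.sq_sqrt (hc j).le]
    have hk := hc k
    have hj := hc j
    have hkj := hw (k - j)
    have := wtp_sub m k j
    have h1 := wtp_le m k
    have h2 := wtp_le m j
    have e : 4 ^ m * ((wtp (m:ℝ) (k - j))⁻¹ * ‖V (k - j)‖ ^ 2 * (cplus m j + l)⁻¹ +
        (wtp (m:ℝ) (k - j))⁻¹ * ‖V (k - j)‖ ^ 2 * (cplus m k + l)⁻¹) =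
        ‖V (k - j)‖ ^ 2 * ((4 ^ m * ((cplus m k + l) + (cplus m j + l))) / wtp (m:ℝ) (k - j)) /
        ((cplus m k + l) * (cplus m j + l)) := by
      field_simp
    rw [e]
    gcongr
    apply le_mul_of_one_le_right (by positivity)
    rw [one_le_div hkj]
    refine this.trans ?_
    gcongr <;> linarith
  have hs : Summable fun p : ℤ × ℤ => ‖kap m V l p.1 p.2‖ ^ 2 :=
    Summable.of_nonneg_of_le (fun p => by positivity) hle h3.summable
  refine ⟨hs, ?_⟩
  rw [← h3.tsum_eq]
  exact hs.tsum_le_tsum hle h3.summable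

lemma cs {ι : Type*} (a b : ι → ℂ) (ha : Summable fun i => ‖a i‖ ^ 2)
    (hb : Summable fun i => ‖b i‖ ^ 2) :
    (Summable fun i => a i * b i) ∧
      ‖∑' i, a i * b i‖ ^ 2 ≤ (∑' i, ‖a i‖ ^ 2) * ∑' i, ‖b i‖ ^ 2 := by
  have h := Real.summable_and_inner_le_Lp_mul_Lq_tsum_of_nonneg (p := 2) (q := 2)
    (f := fun i => ‖a i‖) (g := fun i => ‖b i‖)
    (by constructor <;> norm_num) (fun i => norm_nonneg _)
    (fun i => norm_nonneg _) (by simpa using ha) (by simpa using hb)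
  have hs : Summable fun i => ‖a i * b i‖ := by simpa using h.1
  refine ⟨hs.of_norm, ?_⟩
  have h1 := norm_tsum_le_tsum_norm hs
  have h2 := h.2
  simp only [Real.rpow_two, ← Real.sqrt_eq_rpow] at h2
  simp only [norm_mul] at h1
  have h3 := h1.trans h2
  calc _ ≤ (√(∑' i, ‖a i‖ ^ 2) * √(∑' i, ‖b i‖ ^ 2)) ^ 2 :=
        pow_le_pow_left₀ (norm_nonneg _) h3 2
    _ = _ := by
      rw [mul_pow, Real.sq_sqrt (tsum_nonneg fun i => by positivity),
        Real.sq_sqrt (tsum_nonneg fun i => by positivity)]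

abbrev E2 := lp (fun _ : ℤ => ℂ) 2

lemma E2_summable (x : E2) : Summable fun k => ‖x k‖ ^ 2 := by
  have := (lp.memℓp x).summable (by norm_num)
  simpa using this

lemma E2_norm (x : E2) : ‖x‖ ^ 2 = ∑' k, ‖x k‖ ^ 2 := by
  have := lp.norm_rpow_eq_tsum (p := 2) (by norm_num) x
  simpa using this

def mkE2 (x : ℤ → ℂ) (h : Summable fun k => ‖x k‖ ^ 2) : E2 :=
  ⟨x, memℓp_gen (by simpa using h)⟩

lemma mkE2_apply (x : ℤ → ℂ) (h : Summable fun k => ‖x k‖ ^ 2) (k : ℤ) : mkE2 x h k = x k := rfl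

lemma exists_HS (κ : ℤ → ℤ → ℂ) (h : Summable fun p : ℤ × ℤ => ‖κ p.1 p.2‖ ^ 2) :
    ∃ T : E2 →L[ℂ] E2, (∀ x k, T x k = ∑' j, κ k j * x j) ∧
      ‖T‖ ≤ √(∑' p : ℤ × ℤ, ‖κ p.1 p.2‖ ^ 2) := by
  have hrow : ∀ k, Summable fun j => ‖κ k j‖ ^ 2 := fun k => h.prod_factor k
  have hcol : Summable fun k => ∑' j, ‖κ k j‖ ^ 2 := h.prod
  have hle : ∀ (x : E2) k, ‖∑' j, κ k j * x j‖ ^ 2 ≤ (∑' j, ‖κ k j‖ ^ 2) * ‖x‖ ^ 2 := by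
    intro x k
    rw [E2_norm]
    exact (cs _ _ (hrow k) (E2_summable x)).2
  have hs : ∀ x : E2, Summable fun k => ‖∑' j, κ k j * x j‖ ^ 2 := fun x =>
    Summable.of_nonneg_of_le (fun k => by positivity) (hle x) (hcol.mul_right _)
  let L : E2 →ₗ[ℂ] E2 :=
    { toFun := fun x => mkE2 _ (hs x)
      map_add' := by
        intro x y
        ext k
        simp only [mkE2_apply, lp.coeFn_add, Pi.add_apply, mul_add]
        exact (cs _ _ (hrow k) (E2_summable x)).1.tsum_add (cs _ _ (hrow k) (E2_summable y)).1
      map_smul' := by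
        intro c x
        ext k
        simp only [mkE2_apply, lp.coeFn_smul, Pi.smul_apply, smul_eq_mul, RingHom.id_apply]
        rw [← tsum_mul_left]
        congr 1; ext j; ring }
  refine ⟨L.mkContinuous (√(∑' p : ℤ × ℤ, ‖κ p.1 p.2‖ ^ 2)) ?_, fun x k => rfl,
    L.mkContinuous_norm_le (Real.sqrt_nonneg _) _⟩
  intro x
  refine (pow_le_pow_iff_left₀ (norm_nonneg _) (by positivity) two_ne_zero).1 ?_
  rw [mul_pow, Real.sq_sqrt (tsum_nonneg fun i => by positivity), E2_norm, h.tsum_prod,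
    ← tsum_mul_right]
  exact (hs x).tsum_le_tsum (hle x) (hcol.mul_right _)

def Vst (V : ℤ → ℂ) : ℤ → ℂ := fun k => (starRingEnd ℂ) (V (-k))

lemma wtp_symm (s : ℝ) (k : ℤ) : wtp s (-k) = wtp s k := by
  unfold wtp; simp

lemma Vst_summable {m : ℕ} {V : ℤ → ℂ}
    (hV : Summable fun k : ℤ => wtp (-(m : ℝ)) k * ‖V k‖ ^ 2) :
    Summable fun k : ℤ => wtp (-(m : ℝ)) k * ‖Vst V k‖ ^ 2 := by
  have := (Equiv.neg ℤ).summable_iff.2 hV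
  refine this.congr fun k => ?_
  simp [Vst, wtp_symm]

section fixed
variable {m : ℕ} {l : ℝ}

lemma mupos (hl : 1 ≤ l) (k : ℤ) : 0 < √(cplus m k + l) :=
  Real.sqrt_pos.2 (by linarith [cplus_nonneg m k])

lemma mune (hl : 1 ≤ l) (k : ℤ) : (√(cplus m k + l) : ℂ) ≠ 0 := by
  exact_mod_cast (mupos hl k).ne'

lemma musq (hl : 1 ≤ l) (k : ℤ) :
    (√(cplus m k + l) : ℂ) * (√(cplus m k + l) : ℂ) = cplus m k + l := by
  rw [← Complex.ofReal_mul, Real.mul_self_sqrt (by linarith [cplus_nonneg m k])]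
  push_cast; rfl

/-- Scaling from `H^m` to `ℓ²`. -/
lemma scale_summable (hl : 1 ≤ l) (u : ℤ → ℂ)
    (hu : Summable fun k : ℤ => wtp (m : ℝ) k * ‖u k‖ ^ 2) :
    Summable fun k => ‖(√(cplus m k + l) : ℂ) * u k‖ ^ 2 := by
  refine Summable.of_nonneg_of_le (fun k => by positivity) (fun k => ?_)
    (hu.mul_left (Real.pi ^ (2 * m) + l))
  have h0 := cplus_nonneg m k
  rw [norm_mul, mul_pow, Complex.norm_real, Real.norm_of_nonneg (Real.sqrt_nonneg _),
    Real.sq_sqrt (by linarith), ← mul_assoc]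
  apply mul_le_mul_of_nonneg_right _ (by positivity)
  nlinarith [cplus_le m k, wtp_ge_one m k]

lemma unscale_summable (hl : 1 ≤ l) (x : ℤ → ℂ) (hx : Summable fun k => ‖x k‖ ^ 2) :
    Summable fun k : ℤ => wtp (m : ℝ) k * ‖x k / (√(cplus m k + l) : ℂ)‖ ^ 2 := by
  have hw : ∀ k, 0 < wtp (m:ℝ) k := fun k => by linarith [wtp_ge_one m k]
  refine Summable.of_nonneg_of_le (fun k => by have := hw k; positivity) (fun k => ?_) hx
  have h0 := cplus_nonneg m k
  rw [norm_div, div_pow, Complex.norm_real, Real.norm_of_nonneg (Real.sqrt_nonneg _),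
    Real.sq_sqrt (by linarith), ← mul_div_assoc, div_le_iff₀ (by linarith), mul_comm]
  apply mul_le_mul_of_nonneg_left _ (by positivity)
  linarith [wtp_le m k]

lemma l2_of_Hm (u : ℤ → ℂ) (hu : Summable fun k : ℤ => wtp (m : ℝ) k * ‖u k‖ ^ 2) :
    Summable fun k => ‖u k‖ ^ 2 := by
  refine Summable.of_nonneg_of_le (fun k => by positivity) (fun k => ?_) hu
  exact le_mul_of_one_le_left (by positivity) (wtp_ge_one m k)

lemma div_mu_l2 (hl : 1 ≤ l) (x : ℤ → ℂ) (hx : Summable fun k => ‖x k‖ ^ 2) :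
    Summable fun k => ‖x k / (√(cplus m k + l) : ℂ)‖ ^ 2 :=
  l2_of_Hm _ (unscale_summable hl x hx)

lemma kap_conv (hl : 1 ≤ l) (V : ℤ → ℂ) (x : ℤ → ℂ) (k : ℤ) :
    (√(cplus m k + l) : ℂ) * ∑' j, kap m V l k j * x j =
      conv V (fun j => x j / (√(cplus m j + l) : ℂ)) k := by
  unfold conv
  rw [← tsum_mul_left]
  congr 1; ext j
  have h1 := mune (m := m) hl k
  have h2 := mune (m := m) hl j
  unfold kap
  field_simp

/-- The graph of `S` in scaled coordinates. -/
lemma mem_of_solve (hl : 1 ≤ l) (V : ℤ → ℂ) (T : E2 →L[ℂ] E2)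
    (hT : ∀ x k, T x k = ∑' j, kap m V l k j * x j) (f : ℤ → ℂ)
    (hf : Summable fun k => ‖f k‖ ^ 2) (x : E2)
    (hx : ∀ k, x k + T x k = f k / (√(cplus m k + l) : ℂ)) :
    ((fun k => x k / (√(cplus m k + l) : ℂ)),
      (fun k => f k - l * (x k / (√(cplus m k + l) : ℂ)))) ∈ graphS m V := by
  refine ⟨unscale_summable hl x (E2_summable x), ?_, ?_⟩
  · have h1 := E2_summable (mkE2 f hf - (l:ℂ) • mkE2 _ (div_mu_l2 (m := m) hl x (E2_summable x)))
    exact h1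
  · intro k
    have h := hx k
    have h1 := mune (m := m) hl k
    have h3 := musq (m := m) hl k
    simp only
    rw [← kap_conv hl, ← hT]
    rw [eq_div_iff h1] at h
    rw [← h]
    field_simp
    linear_combination (x k) * h3

end fixed

/-- For `l` large the scaled perturbation is a strict contraction. -/
lemma exists_l (m : ℕ) (hm : 1 ≤ m) (V : ℤ → ℂ)
    (hV : Summable fun k : ℤ => wtp (-(m : ℝ)) k * ‖V k‖ ^ 2) :
    ∃ l : ℝ, 1 ≤ l ∧ ∃ T : E2 →L[ℂ] E2, (∀ x k, T x k = ∑' j, kap m V l k j * x j) ∧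
      ∃ R : E2 →L[ℂ] E2, ∀ y, R y + T (R y) = y ∧ R (y + T y) = y := by
  have ht := ((tendsto_inv_sum m hm).const_mul
    (4 ^ m * (2 * (∑' k : ℤ, wtp (-(m : ℝ)) k * ‖V k‖ ^ 2))))
  rw [mul_zero] at ht
  obtain ⟨l, hl1, hl⟩ := ((Filter.eventually_ge_atTop 1).and
    (ht.eventually (gt_mem_nhds one_pos))).exists
  obtain ⟨hs, hle⟩ := kap_sum m hm V hV l hl1
  obtain ⟨T, hT, hn⟩ := exists_HS _ hs
  refine ⟨l, hl1, T, hT, ?_⟩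
  have hn1 : ‖-T‖ < 1 := by
    rw [norm_neg]
    refine hn.trans_lt ?_
    rw [Real.sqrt_lt' one_pos]
    refine hle.trans_lt ?_
    linarith
  obtain ⟨U, hU⟩ := isUnit_one_sub_of_norm_lt_one hn1
  rw [sub_neg_eq_add] at hU
  refine ⟨(U⁻¹ : (E2 →L[ℂ] E2)ˣ), fun y => ⟨?_, ?_⟩⟩
  · have h := U.mul_inv
    rw [hU] at h
    have := congrArg (fun S : E2 →L[ℂ] E2 => S y) h
    simpa using this
  · have h := U.inv_mul
    rw [hU] at h
    have := congrArg (fun S : E2 →L[ℂ] E2 => S y) h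
    simpa using this

lemma resolventS (m : ℕ) (hm : 1 ≤ m) (V : ℤ → ℂ)
    (hV : Summable fun k : ℤ => wtp (-(m : ℝ)) k * ‖V k‖ ^ 2) :
    ∃ l : ℝ, ∀ f : ℤ → ℂ, (Summable fun k => ‖f k‖ ^ 2) →
      ∃ u : ℤ → ℂ, (u, fun k => f k - l * u k) ∈ graphS m V := by
  obtain ⟨l, hl, T, hT, R, hR⟩ := exists_l m hm V hV
  refine ⟨l, fun f hf => ?_⟩
  let g := mkE2 _ (div_mu_l2 (m := m) hl f hf)
  refine ⟨_, mem_of_solve hl V T hT f hf (R g) fun k => ?_⟩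
  have := congrArg (fun z : E2 => z k) (hR g).1
  exact this

lemma symm_aux (m : ℕ) (hm : 1 ≤ m) (V : ℤ → ℂ)
    (hV : Summable fun k : ℤ => wtp (-(m : ℝ)) k * ‖V k‖ ^ 2)
    (p q : (ℤ → ℂ) × (ℤ → ℂ)) (hp : p ∈ graphS m V) (hq : q ∈ graphS m (Vst V)) :
    L2inner p.2 q.1 = L2inner p.1 q.2 := by
  obtain ⟨u, w⟩ := p
  obtain ⟨v, z⟩ := q
  obtain ⟨hu, hw, hpe⟩ := hp
  obtain ⟨hv, hz, hqe⟩ := hq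
  simp only at *
  have hl : (1:ℝ) ≤ 1 := le_rfl
  have hx := scale_summable (m := m) hl u hu
  have hy := scale_summable (m := m) hl v hv
  -- the double sum is absolutely convergent
  have hF : Summable fun p : ℤ × ℤ => V (p.1 - p.2) * u p.2 * (starRingEnd ℂ) (v p.1) := by
    have hxy := Summable.mul_of_nonneg hy hx (fun _ => by positivity) (fun _ => by positivity)
    have h := (cs (fun p : ℤ × ℤ => kap m V 1 p.1 p.2)
      (fun p : ℤ × ℤ => ((√(cplus m p.2 + 1) : ℂ) * u p.2) *
        (starRingEnd ℂ) ((√(cplus m p.1 + 1) : ℂ) * v p.1))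
      (kap_sum m hm V hV 1 hl).1 (by
        refine hxy.congr fun p => ?_
        rw [norm_mul (_ * u p.2), RCLike.norm_conj, mul_pow, mul_comm])).1
    refine h.congr fun p => ?_
    have h1 := mune (m := m) hl p.1
    have h2 := mune (m := m) hl p.2
    simp only [kap, map_mul, Complex.conj_ofReal]
    field_simp
  have hc : Summable fun k => (cplus m k : ℂ) * u k * (starRingEnd ℂ) (v k) := by
    have hxy := (cs (fun k => (√(cplus m k + 1) : ℂ) * u k)
      (fun k => (starRingEnd ℂ) ((√(cplus m k + 1) : ℂ) * v k)) hx
      (by simpa only [RCLike.norm_conj] using hy)).1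
    have huv := (cs u (fun k => (starRingEnd ℂ) (v k)) (l2_of_Hm _ hu)
      (by simpa only [RCLike.norm_conj] using l2_of_Hm _ hv)).1
    refine (hxy.sub huv).congr fun k => ?_
    have h3 := musq (m := m) hl k
    simp only [map_mul, Complex.conj_ofReal]
    push_cast at h3
    linear_combination u k * (starRingEnd ℂ) (v k) * h3
  have e1 : ∀ k, w k * (starRingEnd ℂ) (v k) = (cplus m k : ℂ) * u k * (starRingEnd ℂ) (v k) +
      ∑' j, V (k - j) * u j * (starRingEnd ℂ) (v k) := by
    intro k
    rw [hpe, tsum_mul_right, add_mul]; rfl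
  have e2 : ∀ k, u k * (starRingEnd ℂ) (z k) = (cplus m k : ℂ) * u k * (starRingEnd ℂ) (v k) +
      ∑' j, V (j - k) * u k * (starRingEnd ℂ) (v j) := by
    intro k
    rw [hqe, map_add, map_mul, Complex.conj_ofReal, mul_add]
    congr 1
    · ring
    · unfold conv
      rw [Complex.conj_tsum, ← tsum_mul_left]
      congr 1; ext j
      simp only [Vst, map_mul, Complex.conj_conj, neg_sub]
      ring
  unfold L2inner
  simp only [e1, e2]
  have hs2 : Summable fun k => ∑' j, V (j - k) * u k * (starRingEnd ℂ) (v j) := hF.prod_symm.prod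
  rw [hc.tsum_add hF.prod, hc.tsum_add hs2]
  congr 1
  exact (Summable.tsum_comm (f := fun k j => V (k - j) * u j * (starRingEnd ℂ) (v k)) hF).symm

lemma L2inner_self {f : ℤ → ℂ} (hf : Summable fun k => ‖f k‖ ^ 2) (h : L2inner f f = 0) :
    f = 0 := by
  unfold L2inner at h
  have h1 : ∀ k, f k * (starRingEnd ℂ) (f k) = ((‖f k‖ ^ 2 : ℝ) : ℂ) := fun k => by
    rw [Complex.mul_conj, Complex.normSq_eq_norm_sq]
  simp only [h1] at h
  rw [← Complex.ofReal_tsum, Complex.ofReal_eq_zero] at h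
  have h2 := (hasSum_zero_iff_of_nonneg (fun k => by positivity)).1 (h ▸ hf.hasSum)
  ext k
  have := congrFun h2 k
  simpa using this

lemma Vst_real {V : ℤ → ℂ} (h : ∀ k : ℤ, V k = (starRingEnd ℂ) (V (-k))) : Vst V = V := by
  ext k; exact (h k).symm

lemma adj_sub (m : ℕ) (hm : 1 ≤ m) (V : ℤ → ℂ)
    (hV : Summable fun k : ℤ => wtp (-(m : ℝ)) k * ‖V k‖ ^ 2)
    (h : ∀ k : ℤ, V k = (starRingEnd ℂ) (V (-k))) :
    adjGraph (graphS m V) ⊆ graphS m V := by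
  obtain ⟨l, hl⟩ := resolventS m hm V hV
  rintro ⟨v, z⟩ ⟨hv, hz, hq⟩
  simp only at hv hz hq
  obtain ⟨u, hu⟩ := hl (fun k => z k + l * v k)
    (E2_summable (mkE2 z hz + (l:ℂ) • mkE2 v hv))
  have hu2 : Summable fun k => ‖u k‖ ^ 2 := l2_of_Hm _ hu.1
  have hd : Summable fun k => ‖v k - u k‖ ^ 2 := E2_summable (mkE2 v hv - mkE2 u hu2)
  obtain ⟨a, ha⟩ := hl (fun k => v k - u k) hd
  have h1 := hq _ ha
  have h2 := symm_aux m hm V hV _ _ ha (by rw [Vst_real h]; exact hu)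
  have ha2 : Summable fun k => ‖a k‖ ^ 2 := l2_of_Hm _ ha.1
  have hb2 := ha.2.1
  simp only at h1 h2 hb2
  set b : ℤ → ℂ := fun k => v k - u k - l * a k with hb
  have S : ∀ f g : ℤ → ℂ, (Summable fun k => ‖f k‖ ^ 2) → (Summable fun k => ‖g k‖ ^ 2) →
      Summable fun k => f k * (starRingEnd ℂ) (g k) := fun f g hf hg =>
    (cs f (fun k => (starRingEnd ℂ) (g k)) hf (by simpa only [RCLike.norm_conj] using hg)).1
  have h3 : L2inner (fun k => v k - u k) (fun k => v k - u k) = 0 := by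
    have e1 : L2inner b v - L2inner b u = ∑' k, b k * (starRingEnd ℂ) (v k - u k) := by
      unfold L2inner
      rw [← (S b v hb2 hv).tsum_sub (S b u hb2 hu2)]
      congr 1; ext k; rw [map_sub]; ring
    have e2 : L2inner a z - L2inner a (fun k => z k + l * v k - l * u k) =
        ∑' k, - (l * (a k * (starRingEnd ℂ) (v k - u k))) := by
      unfold L2inner
      rw [← (S a z ha2 hz).tsum_sub (S a _ ha2 hu.2.1)]
      congr 1; ext k
      simp only [map_sub, map_add, map_mul, Complex.conj_ofReal]; ring
    rw [h1, h2, e2] at e1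
    have e3 := sub_eq_zero.2 e1.symm
    have sa := S a _ ha2 hd
    rw [← (S b _ hb2 hd).tsum_sub (sa.mul_left (l:ℂ)).neg] at e3
    rw [← e3]
    unfold L2inner
    congr 1; ext k; simp only [hb]; ring
  have h4 := L2inner_self hd h3
  have h5 : u = v := by
    ext k; have := congrFun h4 k; simp only [Pi.zero_apply] at this
    exact (sub_eq_zero.1 this).symm
  subst h5
  have e : (fun k => z k + l * u k - l * u k) = z := by ext k; ring
  rw [e] at hu
  exact hu

lemma real_of_eq (m : ℕ) (hm : 1 ≤ m) (V : ℤ → ℂ)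
    (hV : Summable fun k : ℤ => wtp (-(m : ℝ)) k * ‖V k‖ ^ 2)
    (h : adjGraph (graphS m V) = graphS m V) : Vst V = V := by
  have hsub : ∀ q ∈ graphS m (Vst V), q ∈ graphS m V := by
    intro q hq
    rw [← h]
    exact ⟨l2_of_Hm _ hq.1, hq.2.1, fun p hp => symm_aux m hm V hV p q hp hq⟩
  obtain ⟨l, hl, T, hT, R, hR⟩ := exists_l m hm (Vst V) (Vst_summable hV)
  obtain ⟨T', hT', -⟩ := exists_HS _ (kap_sum m hm V hV l hl).1
  -- agreement on the range of `R` applied to the unit vectors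
  have key : ∀ i : ℤ, ∀ c : ℂ, T' (R (lp.single 2 i c)) = T (R (lp.single 2 i c)) := by
    intro i c
    let f : ℤ → ℂ := fun k => (√(cplus m k + l) : ℂ) * (lp.single 2 i c : E2) k
    have hf : Summable fun k => ‖f k‖ ^ 2 := by
      apply summable_of_ne_finset_zero (s := {i})
      intro k hk
      have : k ≠ i := by simpa using hk
      simp only [f]
      rw [lp.single_apply_ne _ _ _ this]; simp
    set x := R (lp.single 2 i c) with hxdef
    have hmem := mem_of_solve hl (Vst V) T hT f hf x (fun k => by
      have := congrArg (fun z : E2 => z k) (hR (lp.single 2 i c)).1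
      simp only [f]
      rw [mul_div_cancel_left₀ _ (mune hl k)]
      exact this)
    have h1 := hmem.2.2
    have h2 := (hsub _ hmem).2.2
    ext k
    have e := (h1 k).symm.trans (h2 k)
    have e' := add_left_cancel e
    simp only at e'
    rw [← kap_conv hl, ← kap_conv hl, ← hT, ← hT'] at e'
    exact (mul_left_cancel₀ (mune hl k) e').symm
  have key2 : ∀ y : E2, T' (R y) = T (R y) := by
    intro y
    have hs := lp.hasSum_single (p := 2) (by norm_num) y
    have s1 := hs.mapL (T'.comp R)
    have s2 := hs.mapL (T.comp R)
    have e : (fun i => (T'.comp R) (lp.single 2 i (y i))) =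
      (fun i => (T.comp R) (lp.single 2 i (y i))) := by
      ext1 i; exact key i _
    rw [e] at s1
    exact s1.unique s2
  have key3 : ∀ y : E2, T' y = T y := by
    intro y
    have := key2 (y + T y)
    rwa [(hR y).2] at this
  ext k
  have h0 := congrArg (fun z : E2 => z k) (key3 (lp.single 2 0 1))
  simp only [hT, hT'] at h0
  rw [tsum_eq_single 0 (fun j hj => by rw [lp.single_apply_ne _ _ _ hj, mul_zero]),
    tsum_eq_single 0 (fun j hj => by rw [lp.single_apply_ne _ _ _ hj, mul_zero]),
    lp.single_apply_self, mul_one, mul_one] at h0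
  unfold kap at h0
  rw [div_left_inj' (mul_ne_zero (mune hl k) (mune hl 0)), sub_zero] at h0
  exact h0.symm

theorem selfadjoint_iff_real (m : ℕ) (hm : 1 ≤ m) (V : ℤ → ℂ)
    (hV : Summable fun k : ℤ => wtp (-(m : ℝ)) k * ‖V k‖ ^ 2) :
    adjGraph (graphS m V) = graphS m V ↔
      ∀ k : ℤ, V k = (starRingEnd ℂ) (V (-k)) := by
  constructor
  · intro h k
    exact (congrFun (real_of_eq m hm V hV h) k).symm
  · intro h
    refine Set.Subset.antisymm (adj_sub m hm V hV h) ?_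
    intro q hq
    exact ⟨l2_of_Hm _ hq.1, hq.2.1, fun p hp =>
      symm_aux m hm V hV p q hp (by rw [Vst_real h]; exact hq)⟩
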